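/- arXiv:2307.01319 — 3 statements merged into one kernel-verified Lean document; each statement's English description precedes it below -/
import Mathlib

section
/- Assume in addition that λ2 < 2λ1. Then for every x ∈ ℝ and every y > 0, the drift of the volatility in the 2-factor PDV model is bounded below: −β1·λ1·x + (λ2·β2/2)·(σ(x,y)² − y)/√y ≥ −λ1·σ(x,y). (This is the drift comparison inequality underlying the proof that σ stays strictly positive in the 2-factor model when λ2 < 2λ1.) -/
/-- In the 2-factor PDV model with volatility
`σ(x,y) = β0 + β1·x + β2·√y`, if `λ2 < 2λ1` then for all `x ∈ ℝ` and `y > 0`,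
the drift of the volatility is bounded below:
`−β1·λ1·x + (λ2·β2/2)·(σ(x,y)² − y)/√y ≥ −λ1·σ(x,y)`. -/
theorem stmt_2 (β0 β1 β2 lam1 lam2 : ℝ)
    (hβ0 : 0 ≤ β0) (hβ1 : β1 ≤ 0) (hβ2 : 0 ≤ β2)
    (hlam1 : 0 ≤ lam1) (hlam2 : 0 ≤ lam2)
    (hlam : lam2 < 2 * lam1)
    (x y : ℝ) (hy : 0 < y) :
    -β1 * lam1 * x +
        (lam2 * β2 / 2) *
          (((β0 + β1 * x + β2 * Real.sqrt y) ^ 2 - y) / Real.sqrt y) ≥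
      -lam1 * (β0 + β1 * x + β2 * Real.sqrt y) := by
  have hs : 0 < Real.sqrt y := Real.sqrt_pos.mpr hy
  have hsq : y = Real.sqrt y ^ 2 := (Real.sq_sqrt hy.le).symm
  generalize Real.sqrt y = s at hs hsq ⊢
  subst hsq
  have hdiv : ((β0 + β1 * x + β2 * s) ^ 2 - s ^ 2) / s =
      (β0 + β1 * x + β2 * s) ^ 2 / s - s := by
    field_simp
  rw [hdiv]
  have hlevel : 0 ≤ lam1 * β0 := mul_nonneg hlam1 hβ0
  have hgap : 0 ≤ (lam1 - lam2 / 2) * (β2 * s) :=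
    mul_nonneg (by linarith) (mul_nonneg hβ2 hs.le)
  have hquad : 0 ≤ lam2 * β2 / 2 * ((β0 + β1 * x + β2 * s) ^ 2 / s) := by
    positivity
  linarith
end

section
/- For every N > 0 and ε > 0 there exists K > 0 such that for all (x,y), (x',y') ∈ ℝ² with ‖(x,y)‖ ≤ N, ‖(x',y')‖ ≤ N, y ≥ ε and y' ≥ ε, one has ‖ν(x,y) − ν(x',y')‖² + ‖b(x,y) − b(x',y')‖² ≤ K·‖(x,y) − (x',y')‖², where ν(x,y) = (λ1·σ(x,y), 0) and b(x,y) = (−λ1·x, λ2·(σ(x,y)² − y)). (This local Lipschitz estimate is the key step in the proof of pathwise uniqueness for the 2-factor PDV SDE.) -/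
open scoped RealInnerProductSpace

/-- A point of `ℝ²` with the Euclidean norm. -/
noncomputable def vec2 (x y : ℝ) : EuclideanSpace ℝ (Fin 2) :=
  (WithLp.equiv 2 (Fin 2 → ℝ)).symm ![x, y]

theorem norm_vec2_sub_sq (a b c d : ℝ) :
    ‖vec2 a b - vec2 c d‖ ^ 2 = (a - c) ^ 2 + (b - d) ^ 2 := by
  simp [vec2, EuclideanSpace.norm_sq_eq, Fin.sum_univ_two]

theorem norm_vec2_sq (a b : ℝ) : ‖vec2 a b‖ ^ 2 = a ^ 2 + b ^ 2 := by
  simp [vec2, EuclideanSpace.norm_sq_eq, Fin.sum_univ_two]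

theorem sq_sqrt_sub_sqrt_le {ε y z : ℝ} (hε : 0 < ε) (hy : ε ≤ y) (hz : ε ≤ z) :
    (√y - √z) ^ 2 ≤ (y - z) ^ 2 / ε := by
  have h1 := Real.sq_sqrt (hε.le.trans hy)
  have h2 := Real.sq_sqrt (hε.le.trans hz)
  have h3 : ε ≤ (√y + √z) ^ 2 := by
    nlinarith [mul_nonneg (Real.sqrt_nonneg y) (Real.sqrt_nonneg z)]
  have h4 : y - z = (√y - √z) * (√y + √z) := by linear_combination h2 - h1
  rw [le_div_iff₀ hε, h4, mul_pow]
  exact mul_le_mul_of_nonneg_left h3 (sq_nonneg _)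

theorem add_sq_le_two_mul (a b : ℝ) : (a + b) ^ 2 ≤ 2 * a ^ 2 + 2 * b ^ 2 := by
  nlinarith [sq_nonneg (a - b)]

/-- The volatility of the 2-factor PDV model is Lipschitz on `{y | ε ≤ y}`. -/
theorem sq_volatility_sub_le (β0 β1 β2 : ℝ) {ε y z : ℝ} (x w : ℝ)
    (hε : 0 < ε) (hy : ε ≤ y) (hz : ε ≤ z) :
    ((β0 + β1 * x + β2 * √y) - (β0 + β1 * w + β2 * √z)) ^ 2 ≤
      (2 * β1 ^ 2 + 2 * β2 ^ 2 / ε) * ((x - w) ^ 2 + (y - z) ^ 2) := by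
  have h := mul_le_mul_of_nonneg_left (sq_sqrt_sub_sqrt_le hε hy hz) (sq_nonneg β2)
  calc ((β0 + β1 * x + β2 * √y) - (β0 + β1 * w + β2 * √z)) ^ 2
      = (β1 * (x - w) + β2 * (√y - √z)) ^ 2 := by ring
    _ ≤ 2 * (β1 * (x - w)) ^ 2 + 2 * (β2 * (√y - √z)) ^ 2 := add_sq_le_two_mul _ _
    _ ≤ 2 * β1 ^ 2 * (x - w) ^ 2 + 2 * β2 ^ 2 / ε * (y - z) ^ 2 := by
        have e : 2 * β2 ^ 2 / ε * (y - z) ^ 2 = 2 * (β2 ^ 2 * ((y - z) ^ 2 / ε)) := by ring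
        rw [e]
        linarith
    _ ≤ _ := by
        have h1 : 0 ≤ 2 * β1 ^ 2 * (y - z) ^ 2 := by positivity
        have h2 : 0 ≤ 2 * β2 ^ 2 / ε * (x - w) ^ 2 := by positivity
        linarith

/-- The volatility of the 2-factor PDV model is bounded on the ball of radius `N`. -/
theorem sq_volatility_le (β0 β1 β2 : ℝ) {N x y : ℝ} (hN : 0 ≤ N) (hy : 0 ≤ y)
    (h : ‖vec2 x y‖ ≤ N) :
    (β0 + β1 * x + β2 * √y) ^ 2 ≤ 4 * (β0 ^ 2 + β1 ^ 2 * N ^ 2 + β2 ^ 2 * N) := by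
  have hs : x ^ 2 + y ^ 2 ≤ N ^ 2 := by
    rw [← norm_vec2_sq]
    exact pow_le_pow_left₀ (norm_nonneg _) h 2
  have hyN : y ≤ N := abs_le_of_sq_le_sq' (by nlinarith [sq_nonneg x]) hN |>.2
  have hx := mul_le_mul_of_nonneg_left
    (show x ^ 2 ≤ N ^ 2 by linarith [sq_nonneg y]) (sq_nonneg β1)
  have hr := mul_le_mul_of_nonneg_left hyN (sq_nonneg β2)
  have h1 := add_sq_le_two_mul (β0 + β1 * x) (β2 * √y)
  have h2 := add_sq_le_two_mul β0 (β1 * x)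
  rw [mul_pow β2, Real.sq_sqrt hy] at h1
  rw [mul_pow β1] at h2
  nlinarith [mul_nonneg (sq_nonneg β2) hy]

/-- Local Lipschitz estimate for the coefficients of the 2-factor
PDV SDE, `ν(x,y) = (λ1·σ(x,y), 0)` and `b(x,y) = (−λ1·x, λ2·(σ(x,y)² − y))`
with `σ(x,y) = β0 + β1·x + β2·√y`: for every `N > 0` and `ε > 0` there is
`K > 0` such that for all `(x,y), (x',y')` with `‖(x,y)‖ ≤ N`, `‖(x',y')‖ ≤ N`,
`y ≥ ε`, `y' ≥ ε`, one has
`‖ν(x,y) − ν(x',y')‖² + ‖b(x,y) − b(x',y')‖² ≤ K·‖(x,y) − (x',y')‖²`. -/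
theorem stmt_4 (β0 β1 β2 lam1 lam2 : ℝ)
    (hβ0 : 0 ≤ β0) (hβ1 : β1 ≤ 0) (hβ2 : 0 ≤ β2)
    (hlam1 : 0 ≤ lam1) (hlam2 : 0 ≤ lam2)
    (ν b : ℝ → ℝ → EuclideanSpace ℝ (Fin 2))
    (hν : ∀ x y : ℝ, ν x y = vec2 (lam1 * (β0 + β1 * x + β2 * Real.sqrt y)) 0)
    (hb : ∀ x y : ℝ, b x y =
      vec2 (-lam1 * x)
        (lam2 * ((β0 + β1 * x + β2 * Real.sqrt y) ^ 2 - y))) :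
    ∀ N > (0 : ℝ), ∀ ε > (0 : ℝ), ∃ K > (0 : ℝ),
      ∀ x y x' y' : ℝ,
        ‖vec2 x y‖ ≤ N → ‖vec2 x' y'‖ ≤ N → ε ≤ y → ε ≤ y' →
        ‖ν x y - ν x' y'‖ ^ 2 + ‖b x y - b x' y'‖ ^ 2 ≤
          K * ‖vec2 x y - vec2 x' y'‖ ^ 2 := by
  intro N hN ε hε
  set L := 2 * β1 ^ 2 + 2 * β2 ^ 2 / ε with hL
  set M := 4 * (β0 ^ 2 + β1 ^ 2 * N ^ 2 + β2 ^ 2 * N) with hM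
  have hL0 : 0 ≤ L := by positivity
  have hM0 : 0 ≤ M := by positivity
  refine ⟨lam1 ^ 2 * L + lam1 ^ 2 + lam2 ^ 2 * (2 * (4 * M * L) + 2) + 1, by positivity, ?_⟩
  intro x y x' y' h h' hy hy'
  have hS := sq_volatility_sub_le β0 β1 β2 x x' hε hy hy'
  have hB := sq_volatility_le β0 β1 β2 hN.le (hε.le.trans hy) h
  have hB' := sq_volatility_le β0 β1 β2 hN.le (hε.le.trans hy') h'
  rw [hν, hν, hb, hb, norm_vec2_sub_sq, norm_vec2_sub_sq, norm_vec2_sub_sq]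
  rw [← hL] at hS
  rw [← hM] at hB hB'
  set s := β0 + β1 * x + β2 * √y
  set t := β0 + β1 * x' + β2 * √y'
  have hdx : (x - x') ^ 2 ≤ (x - x') ^ 2 + (y - y') ^ 2 := by linarith [sq_nonneg (y - y')]
  have hdy : (y - y') ^ 2 ≤ (x - x') ^ 2 + (y - y') ^ 2 := by linarith [sq_nonneg (x - x')]
  set D := (x - x') ^ 2 + (y - y') ^ 2
  have hD0 : 0 ≤ D := (sq_nonneg _).trans hdx
  have hst : (s + t) ^ 2 ≤ 4 * M := by linarith [add_sq_le_two_mul s t]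
  have hsq : (s ^ 2 - t ^ 2) ^ 2 ≤ 4 * M * (L * D) :=
    calc (s ^ 2 - t ^ 2) ^ 2 = (s + t) ^ 2 * (s - t) ^ 2 := by ring
      _ ≤ 4 * M * (L * D) := mul_le_mul hst hS (sq_nonneg _) (by positivity)
  have hdrift : ((s ^ 2 - t ^ 2) + (y' - y)) ^ 2 ≤ 2 * (4 * M * (L * D)) + 2 * D := by
    have := add_sq_le_two_mul (s ^ 2 - t ^ 2) (y' - y)
    rw [sub_sq_comm y' y] at this
    linarith
  calc (lam1 * s - lam1 * t) ^ 2 + (0 - 0) ^ 2 + ((-lam1 * x - -lam1 * x') ^ 2 +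
        (lam2 * (s ^ 2 - y) - lam2 * (t ^ 2 - y')) ^ 2)
      = lam1 ^ 2 * (s - t) ^ 2 + lam1 ^ 2 * (x - x') ^ 2 +
        lam2 ^ 2 * ((s ^ 2 - t ^ 2) + (y' - y)) ^ 2 := by ring
    _ ≤ lam1 ^ 2 * (L * D) + lam1 ^ 2 * D +
        lam2 ^ 2 * (2 * (4 * M * (L * D)) + 2 * D) := by gcongr
    _ ≤ _ := by linarith
end

section
/- Let β0 ≥ 0, β1 ≤ 0, β2 ≥ 0, λ1 ≥ 0, λ2 > 0, and let β̂2 > 0 be such that α := β1·λ1 + β̂2·λ2 < 0. Then there exists a constant L ∈ ℝ such that for all x ∈ ℝ and y ≥ 0, α·(β0 + β1·x + β2·√y)² − λ1·β1·x − λ2·β̂2·y ≤ L. (This uniform upper bound on the drift functional under the changed measure is the key estimate in the proof that the tilted 2-factor PDV process does not explode, and hence that the price process is a true martingale.) -/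
/-- A concave quadratic without constant term is bounded by its value at the vertex. -/
theorem linear_sub_sq_le {a : ℝ} (ha : 0 < a) (b t : ℝ) :
    b * t - a * t ^ 2 ≤ b ^ 2 / (4 * a) := by
  rw [le_div_iff₀ (by positivity)]
  nlinarith [sq_nonneg (2 * a * t - b)]


/-- with `α := β1·λ1 + β̂2·λ2 < 0`, there is a constant `L` such
that for all `x ∈ ℝ` and `y ≥ 0`,
`α·(β0 + β1·x + β2·√y)² − λ1·β1·x − λ2·β̂2·y ≤ L`. -/
theorem stmt_9 (β0 β1 β2 lam1 lam2 β2hat : ℝ)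
    (hβ0 : 0 ≤ β0) (hβ1 : β1 ≤ 0) (hβ2 : 0 ≤ β2)
    (hlam1 : 0 ≤ lam1) (hlam2 : 0 < lam2) (hβ2hat : 0 < β2hat)
    (hα : β1 * lam1 + β2hat * lam2 < 0) :
    ∃ L : ℝ, ∀ x y : ℝ, 0 ≤ y →
      (β1 * lam1 + β2hat * lam2) * (β0 + β1 * x + β2 * Real.sqrt y) ^ 2
          - lam1 * β1 * x - lam2 * β2hat * y ≤ L := by
  obtain ⟨a, ha⟩ : ∃ a, a = -(β1 * lam1 + β2hat * lam2) := ⟨_, rfl⟩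
  have ha_pos : 0 < a := by linarith
  have hc_pos : 0 < lam2 * β2hat := mul_pos hlam2 hβ2hat
  refine ⟨(-lam1) ^ 2 / (4 * a) + (lam1 * β2) ^ 2 / (4 * (lam2 * β2hat)) + lam1 * β0,
    fun x y hy => ?_⟩
  have hu := linear_sub_sq_le ha_pos (-lam1) (β0 + β1 * x + β2 * Real.sqrt y)
  have hs := linear_sub_sq_le hc_pos (lam1 * β2) (Real.sqrt y)
  rw [Real.sq_sqrt hy] at hs
  rw [show β1 * lam1 + β2hat * lam2 = -a by linarith]
  linarith
end
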